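/- For each fixed b ∈ ℕ, the random vector (C_1^{(n)}, …, C_b^{(n)}) of cycle counts of a uniform random permutation of n points converges in distribution, as n → ∞, to (Y_1, …, Y_b) where the Y_m are independent Poisson random variables with E[Y_m] = 1/m. -/

import Mathlib

open scoped BigOperators Classical
open Filter

/-- The reciprocal of the order of the centralizer of a permutation whose cycle lengths, fixed
points included, form the multiset `s`. -/
noncomputable def cycleWeight (s : Multiset ℕ) : ℝ :=
  ((s.prod : ℝ) * ∏ x ∈ s.toFinset, ((s.count x).factorial : ℝ))⁻¹

theorem cycleWeight_add_replicate {s : Multiset ℕ} {m : ℕ} (hm : m ∉ s) (j : ℕ) :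
    cycleWeight (s + Multiset.replicate j m) =
      (1 / (m : ℝ)) ^ j / j.factorial * cycleWeight s := by
  have hprod : ∏ x ∈ (s + Multiset.replicate j m).toFinset,
      (((s + Multiset.replicate j m).count x).factorial : ℝ) =
      (j.factorial : ℝ) * ∏ x ∈ s.toFinset, ((s.count x).factorial : ℝ) := by
    have hm' : m ∉ s.toFinset := by simpa using hm
    have hsub : (s + Multiset.replicate j m).toFinset ⊆ insert m s.toFinset := by
      intro x hx
      simp only [Multiset.mem_toFinset, Multiset.mem_add, Multiset.mem_replicate,
        Finset.mem_insert] at hx ⊢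
      tauto
    rw [Finset.prod_subset hsub, Finset.prod_insert hm']
    · congr 1
      · simp [Multiset.count_eq_zero_of_notMem hm]
      · refine Finset.prod_congr rfl fun x hx => ?_
        have hne : m ≠ x := fun h => hm' (h ▸ hx)
        simp [Multiset.count_replicate, hne]
    · intro x _ hx
      rw [Multiset.mem_toFinset] at hx
      simp [Multiset.count_eq_zero_of_notMem hx]
  unfold cycleWeight
  rw [hprod]
  simp only [Multiset.prod_add, Multiset.prod_replicate, Nat.cast_mul, Nat.cast_pow, mul_inv,
    one_div, inv_pow]
  ring

theorem card_perm_partition_parts_eq {n : ℕ} (p : n.Partition) :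
    ((Finset.univ.filter fun σ : Equiv.Perm (Fin n) => σ.partition.parts = p.parts).card : ℝ) /
      n.factorial = cycleWeight p.parts := by
  set t := p.parts.filter (2 ≤ ·) with ht
  have hp : p.parts = t + Multiset.replicate (p.parts.count 1) 1 := by
    ext a
    simp only [ht, Multiset.count_add, Multiset.count_filter, Multiset.count_replicate]
    rcases a with _ | _ | a
    · have : 0 ∉ p.parts := fun h => (p.parts_pos h).ne' rfl
      simp [this]
    · simp
    · simp
  have hsum : t.sum + p.parts.count 1 = n := by
    have := congrArg Multiset.sum hp
    rw [p.parts_sum] at this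
    simpa using this.symm
  have hset : (Finset.univ.filter fun σ : Equiv.Perm (Fin n) => σ.partition.parts = p.parts) =
      Finset.univ.filter fun σ : Equiv.Perm (Fin n) => σ.cycleType = t := by
    ext σ
    simp only [Finset.mem_filter, Finset.mem_univ, true_and]
    constructor
    · intro h
      rw [ht, ← h, Equiv.Perm.filter_parts_partition_eq_cycleType]
    · intro h
      rw [hp, Equiv.Perm.parts_partition, ← Equiv.Perm.sum_cycleType, h, Fintype.card_fin]
      congr 2
      omega
  have h1 : 1 ∉ t := by simp [ht]
  have htpos : ∀ a ∈ t, 2 ≤ a := fun a ha => (Multiset.mem_filter.1 ha).2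
  have hcard := Equiv.Perm.card_of_cycleType_mul_eq (Fin n) t
  rw [if_pos ⟨by rw [Fintype.card_fin]; omega, htpos⟩, Fintype.card_fin,
    show n - t.sum = p.parts.count 1 by omega] at hcard
  rw [hset, hp, cycleWeight_add_replicate h1, cycleWeight, ← hcard]
  have hprod : (t.prod : ℝ) ≠ 0 := by
    exact_mod_cast (Multiset.prod_pos fun a ha => two_pos.trans_le (htpos a ha)).ne'
  have hne : (∏ x ∈ t.toFinset, ((t.count x).factorial : ℝ)) ≠ 0 :=
    Finset.prod_ne_zero_iff.2 fun x _ => by positivity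
  have hcard0 : ((Finset.univ.filter fun σ : Equiv.Perm (Fin n) => σ.cycleType = t).card : ℝ)
      ≠ 0 := by
    intro h
    rw [Nat.cast_eq_zero] at h
    rw [h, zero_mul] at hcard
    exact n.factorial_ne_zero hcard.symm
  push_cast
  field_simp
  simp

/-- The probability that the cycle lengths of a uniform permutation of `n` points satisfy `Q`. -/
noncomputable def cycleProb (Q : Multiset ℕ → Prop) (n : ℕ) : ℝ :=
  ∑ p : n.Partition with Q p.parts, cycleWeight p.parts

theorem card_filter_perm_div_factorial (Q : Multiset ℕ → Prop) (n : ℕ) :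
    ((Finset.univ.filter fun σ : Equiv.Perm (Fin n) => Q σ.partition.parts).card : ℝ) /
      n.factorial = cycleProb Q n := by
  let f : Equiv.Perm (Fin n) → n.Partition := fun σ =>
    ⟨σ.partition.parts, fun h => σ.partition.parts_pos h, by
      rw [σ.partition.parts_sum, Fintype.card_fin]⟩
  rw [Finset.card_eq_sum_card_fiberwise (f := f)
    (t := Finset.univ.filter fun p : n.Partition => Q p.parts), cycleProb, Nat.cast_sum,
    Finset.sum_div]
  · refine Finset.sum_congr rfl fun p hp => ?_
    rw [← card_perm_partition_parts_eq p]
    congr 3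
    ext σ
    simp only [Finset.mem_filter, Finset.mem_univ, true_and, Nat.Partition.ext_iff, f] at hp ⊢
    exact ⟨fun h => h.2, fun h => ⟨h ▸ hp, h⟩⟩
  · intro σ hσ
    simpa [f] using hσ

theorem cycleProb_true (n : ℕ) : cycleProb (fun _ => True) n = 1 := by
  rw [← card_filter_perm_div_factorial]
  simp [Finset.card_univ, Fintype.card_perm, Nat.factorial_ne_zero]

/-- Inserting `j` cycles of length `m`. -/
theorem cycleProb_count_eq {Q : Multiset ℕ → Prop} {m : ℕ} (hm : 0 < m)
    (hQ : ∀ s j, Q (s + Multiset.replicate j m) ↔ Q s) (j n : ℕ) :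
    cycleProb (fun s => Q s ∧ s.count m = j) (n + m * j) =
      (1 / (m : ℝ)) ^ j / j.factorial * cycleProb (fun s => Q s ∧ s.count m = 0) n := by
  have key : ∀ s : Multiset ℕ,
      s.filter (· ≠ m) + Multiset.replicate (s.count m) m = s := by
    intro s
    ext a
    by_cases ha : a = m
    · simp [ha]
    · simp [Multiset.count_replicate, ha, Ne.symm ha]
  have key' : ∀ s : Multiset ℕ, s.count m = 0 →
      (s + Multiset.replicate j m).filter (· ≠ m) = s := by
    intro s hs
    ext a
    by_cases ha : a = m
    · simp [ha, hs]
    · simp [Multiset.count_replicate, ha, Ne.symm ha]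
  rw [cycleProb, cycleProb, Finset.mul_sum]
  symm
  refine Finset.sum_bij'
    (fun p _ => ⟨p.parts + Multiset.replicate j m, ?_, ?_⟩)
    (fun p hp => ⟨p.parts.filter (· ≠ m), ?_, ?_⟩) ?_ ?_ ?_ ?_ ?_
  · intro i hi
    rcases Multiset.mem_add.1 hi with h | h
    · exact p.parts_pos h
    · exact (Multiset.eq_of_mem_replicate h).symm ▸ hm
  · simp [p.parts_sum, mul_comm]
  · intro i hi
    exact p.parts_pos (Multiset.mem_filter.1 hi).1
  · simp only [Finset.mem_filter, Finset.mem_univ, true_and] at hp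
    have h := congrArg Multiset.sum (key p.parts)
    rw [hp.2, p.parts_sum] at h
    simp only [Multiset.sum_add, Multiset.sum_replicate, smul_eq_mul] at h
    rw [mul_comm j m] at h
    omega
  · intro p hp
    simp only [Finset.mem_filter, Finset.mem_univ, true_and] at hp ⊢
    exact ⟨(hQ _ _).2 hp.1, by simp [hp.2]⟩
  · intro p hp
    simp only [Finset.mem_filter, Finset.mem_univ, true_and] at hp ⊢
    refine ⟨(hQ _ j).1 ?_, by simp⟩
    have := key p.parts
    rw [hp.2] at this
    rw [this]
    exact hp.1
  · intro p hp
    simp only [Finset.mem_filter, Finset.mem_univ, true_and] at hp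
    exact Nat.Partition.ext (key' _ hp.2)
  · intro p hp
    simp only [Finset.mem_filter, Finset.mem_univ, true_and] at hp
    refine Nat.Partition.ext ?_
    have := key p.parts
    rw [hp.2] at this
    exact this
  · intro p hp
    simp only [Finset.mem_filter, Finset.mem_univ, true_and] at hp
    exact (cycleWeight_add_replicate (Multiset.count_eq_zero.1 hp.2) j).symm

theorem cycleProb_eq_sum_antidiagonal {Q : Multiset ℕ → Prop} {m : ℕ}
    (hQ : ∀ s j, Q (s + Multiset.replicate j m) ↔ Q s) {r : ℕ} (hr : r < m) (q : ℕ) :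
    cycleProb Q (r + m * q) = ∑ x ∈ Finset.HasAntidiagonal.antidiagonal q,
      (1 / (m : ℝ)) ^ x.1 / x.1.factorial *
        cycleProb (fun s => Q s ∧ s.count m = 0) (r + m * x.2) := by
  have hm : 0 < m := by omega
  have hterm : ∀ x ∈ Finset.HasAntidiagonal.antidiagonal q,
      (1 / (m : ℝ)) ^ x.1 / x.1.factorial *
        cycleProb (fun s => Q s ∧ s.count m = 0) (r + m * x.2) =
      cycleProb (fun s => Q s ∧ s.count m = x.1) (r + m * q) := by
    intro x hx
    rw [← cycleProb_count_eq hm hQ, ← Finset.HasAntidiagonal.mem_antidiagonal.1 hx]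
    congr 1
    ring
  rw [Finset.sum_congr rfl hterm, Finset.Nat.sum_antidiagonal_eq_sum_range_succ
    (fun i _ => cycleProb (fun s => Q s ∧ s.count m = i) (r + m * q))]
  unfold cycleProb
  rw [← Finset.sum_fiberwise_of_maps_to (g := fun p => p.parts.count m)
    (t := Finset.range (q + 1))]
  · simp only [Finset.filter_filter]
  · intro p _
    rw [Finset.mem_range]
    have hle : Multiset.replicate (p.parts.count m) m ≤ p.parts :=
      Multiset.le_count_iff_replicate_le.1 le_rfl
    obtain ⟨u, hu⟩ := Multiset.le_iff_exists_add.1 hle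
    have hs := congrArg Multiset.sum hu
    rw [p.parts_sum] at hs
    simp only [Multiset.sum_add, Multiset.sum_replicate, smul_eq_mul] at hs
    by_contra! hlt
    have h3 : (q + 1) * m ≤ p.parts.count m * m := Nat.mul_le_mul_right m hlt
    have h4 : (q + 1) * m = m * q + m := by ring
    omega

/-- Convolution with the coefficients of `exp (t X)` is inverted by convolution with those of
`exp (-t X)`. -/
theorem eq_sum_antidiagonal_exp_neg {t : ℝ} {u v : ℕ → ℝ}
    (h : ∀ q, u q = ∑ x ∈ Finset.HasAntidiagonal.antidiagonal q, t ^ x.1 / x.1.factorial * v x.2) (q : ℕ) :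
    v q = ∑ x ∈ Finset.HasAntidiagonal.antidiagonal q, (-t) ^ x.1 / x.1.factorial * u x.2 := by
  have hu : PowerSeries.mk u =
      PowerSeries.rescale t (PowerSeries.exp ℝ) * PowerSeries.mk v := by
    ext k
    simp [PowerSeries.coeff_mul, PowerSeries.coeff_rescale, PowerSeries.coeff_exp, h,
      div_eq_mul_inv]
  have hv : PowerSeries.mk v =
      PowerSeries.rescale (-t) (PowerSeries.exp ℝ) * PowerSeries.mk u := by
    rw [hu, ← mul_assoc, PowerSeries.exp_mul_exp_eq_exp_add]
    simp
  have hq := congrArg (PowerSeries.coeff q) hv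
  simpa [PowerSeries.coeff_mul, PowerSeries.coeff_rescale, PowerSeries.coeff_exp,
    div_eq_mul_inv] using hq

theorem tendsto_mul_exp_neg_of_convolution {t L : ℝ} {u v : ℕ → ℝ} {m : ℕ} (hm : 0 < m)
    (h : ∀ r < m, ∀ q, u (r + m * q) =
      ∑ x ∈ Finset.HasAntidiagonal.antidiagonal q, t ^ x.1 / x.1.factorial * v (r + m * x.2))
    (hu : Tendsto u atTop (nhds L)) :
    Tendsto v atTop (nhds (Real.exp (-t) * L)) := by
  obtain ⟨C, hC⟩ := hu.norm.bddAbove_range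
  have hC' : ∀ n, ‖u n‖ ≤ C := fun n => hC ⟨n, rfl⟩
  have hC0 : 0 ≤ C := (norm_nonneg _).trans (hC' 0)
  set f : ℕ → ℕ → ℝ := fun n i =>
    if i ∈ Finset.range (n / m + 1) then (-t) ^ i / i.factorial * u (n - m * i) else 0 with hf
  have hv : ∀ n, v n = ∑' i, f n i := by
    intro n
    rw [tsum_eq_sum (s := Finset.range (n / m + 1)) (fun i hi => if_neg hi),
      Finset.sum_congr rfl (fun i hi => if_pos hi)]
    have hinv := eq_sum_antidiagonal_exp_neg (u := fun q => u (n % m + m * q))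
      (v := fun q => v (n % m + m * q)) (h (n % m) (Nat.mod_lt n hm)) (n / m)
    rw [Nat.mod_add_div, Finset.Nat.sum_antidiagonal_eq_sum_range_succ
      (fun i j => (-t) ^ i / i.factorial * u (n % m + m * j))] at hinv
    rw [hinv]
    refine Finset.sum_congr rfl fun i hi => ?_
    congr 2
    have hi' : i ≤ n / m := Nat.lt_succ_iff.1 (Finset.mem_range.1 hi)
    have h1 := Nat.mod_add_div n m
    have h2 : m * i ≤ m * (n / m) := Nat.mul_le_mul_left m hi'
    rw [Nat.mul_sub]
    omega
  have hexp : ∑' i : ℕ, (-t) ^ i / i.factorial * L = Real.exp (-t) * L := by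
    rw [tsum_mul_right, Real.exp_eq_exp_ℝ, NormedSpace.exp_eq_tsum_div]
  rw [← hexp, funext hv]
  refine tendsto_tsum_of_dominated_convergence
    (bound := fun i : ℕ => |t| ^ i / i.factorial * C)
    ((Real.summable_pow_div_factorial |t|).mul_right C) ?_ ?_
  · intro i
    have hlim : Tendsto (fun n => (-t) ^ i / i.factorial * u (n - m * i)) atTop
        (nhds ((-t) ^ i / i.factorial * L)) :=
      (hu.comp (tendsto_sub_atTop_nat (m * i))).const_mul _
    refine hlim.congr' ?_
    filter_upwards [eventually_ge_atTop (m * i)] with n hn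
    have hi : i ≤ n / m := (Nat.le_div_iff_mul_le hm).2 (by rwa [mul_comm])
    exact (if_pos (Finset.mem_range.2 (Nat.lt_succ_iff.2 hi))).symm
  · refine Eventually.of_forall fun n i => ?_
    simp only [hf]
    split_ifs
    · rw [norm_mul, norm_div, norm_pow, norm_neg, Real.norm_eq_abs t, Real.norm_natCast]
      exact mul_le_mul_of_nonneg_left (hC' _) (by positivity)
    · rw [norm_zero]
      positivity

theorem tendsto_cycleProb_forall_count_eq (b : ℕ) (c : ℕ → ℕ) :
    Tendsto (cycleProb fun s => ∀ m ∈ Finset.Icc 1 b, s.count m = c m) atTop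
      (nhds (∏ m ∈ Finset.Icc 1 b,
        Real.exp (-(1 / (m : ℝ))) * (1 / (m : ℝ)) ^ c m / (c m).factorial)) := by
  induction b with
  | zero =>
    have : cycleProb (fun s => ∀ m ∈ Finset.Icc 1 0, s.count m = c m) = fun _ => 1 := by
      funext n
      simpa using cycleProb_true n
    rw [this]
    simp
  | succ b ih =>
    set Q : Multiset ℕ → Prop := fun s => ∀ m ∈ Finset.Icc 1 b, s.count m = c m
    have hQ : ∀ s j, Q (s + Multiset.replicate j (b + 1)) ↔ Q s := by
      intro s j
      refine forall₂_congr fun m hm => ?_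
      have hne : b + 1 ≠ m := by
        have := (Finset.mem_Icc.1 hm).2
        omega
      simp [Multiset.count_replicate, hne]
    have hstep : (fun s : Multiset ℕ => ∀ m ∈ Finset.Icc 1 (b + 1), s.count m = c m) =
        fun s => Q s ∧ s.count (b + 1) = c (b + 1) := by
      funext s
      rw [← Finset.insert_Icc_right_eq_Icc_add_one (by omega : 1 ≤ b + 1),
        Finset.forall_mem_insert, and_comm]
    have hlim := tendsto_mul_exp_neg_of_convolution b.succ_pos
      (fun r hr q => cycleProb_eq_sum_antidiagonal hQ hr q) ih
    rw [hstep, Finset.prod_Icc_succ_top (by omega)]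
    have hshift := (hlim.comp (tendsto_sub_atTop_nat ((b + 1) * c (b + 1)))).const_mul
      ((1 / ((b + 1 : ℕ) : ℝ)) ^ c (b + 1) / (c (b + 1)).factorial)
    refine Tendsto.congr' ?_ (hshift.trans_eq ?_)
    · filter_upwards [eventually_ge_atTop ((b + 1) * c (b + 1))] with n hn
      rw [Function.comp_apply, ← cycleProb_count_eq b.succ_pos hQ, Nat.sub_add_cancel hn]
    · congr 1
      ring

/-- For each fixed `b`, the joint distribution of the cycle counts `(C_1^{(n)}, …, C_b^{(n)})`
of a uniform permutation of `n` points converges, as `n → ∞`, to that of independent Poisson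
random variables `(Y_1, …, Y_b)` with `E[Y_m] = 1/m`:  for every `c : ℕ → ℕ`, the probability
that `C_m^{(n)} = c_m` for all `1 ≤ m ≤ b` tends to `∏_{m=1}^b e^{-1/m} (1/m)^{c_m}/c_m!`. -/
theorem stmt15 (b : ℕ) (c : ℕ → ℕ) :
    Tendsto
      (fun n : ℕ =>
        ((Finset.univ.filter fun σ : Equiv.Perm (Fin n) =>
            ∀ m ∈ Finset.Icc 1 b, σ.partition.parts.count m = c m).card : ℝ) /
          Nat.factorial n)
      atTop
      (nhds (∏ m ∈ Finset.Icc 1 b,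
        Real.exp (-(1 / (m : ℝ))) * (1 / (m : ℝ)) ^ c m / (c m).factorial)) := by
  simpa only [card_filter_perm_div_factorial fun s => ∀ m ∈ Finset.Icc 1 b, s.count m = c m]
    using tendsto_cycleProb_forall_count_eq b c
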